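/- arXiv:1402.3570 — 4 statements merged into one kernel-verified Lean document; each statement's English description precedes it below -/
import Mathlib

section
/- Let X₁, …, X_d be P₀-integrable real random variables on (Ω, 𝒜, P₀) and let L = {∑_{j=1}^d b_j X_j : b₁, …, b_d ∈ ℝ}. Suppose every X ∈ L with X ≥ 0 P₀-a.s. satisfies X = 0 P₀-a.s. Then: (i) there is a constant c ∈ [0, 1) such that |E_{P₀}(X)| ≤ c·E_{P₀}(|X|) for every X ∈ L; and (ii) there exist a σ-additive probability measure P on 𝒜 and constants 0 < r ≤ s with r·P₀(A) ≤ P(A) ≤ s·P₀(A) for all A ∈ 𝒜 and E_P(X) = 0 for every X ∈ L. -/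
open MeasureTheory Filter Topology

/-- In a finite dimensional subspace of `L¹` whose only nonnegative element is `0`, the integral is
bounded by a constant smaller than `1` times the norm. -/
theorem exists_abs_integral_le_mul_norm {Ω : Type*} [MeasurableSpace Ω] {μ : Measure Ω}
    (L : Submodule ℝ (Lp ℝ 1 μ)) [FiniteDimensional ℝ L]
    (hL : ∀ v ∈ L, 0 ≤ᵐ[μ] v → v = 0) :
    ∃ c : ℝ, 0 ≤ c ∧ c < 1 ∧ ∀ v ∈ L, |∫ ω, v ω ∂μ| ≤ c * ‖v‖ := by
  have norm_sub_integral_pos : ∀ v ∈ L, v ≠ 0 → 0 < ‖v‖ - ∫ ω, v ω ∂μ := by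
    intro v hv hv0
    have hi := L1.integrable_coeFn v
    rw [L1.norm_eq_integral_norm, ← integral_sub hi.norm hi]
    have hnn : 0 ≤ fun ω => ‖v ω‖ - v ω := fun ω => sub_nonneg.2 (le_abs_self _)
    refine lt_of_le_of_ne (integral_nonneg hnn) fun h => hv0 (hL v hv ?_)
    have := (integral_eq_zero_iff_of_nonneg hnn (hi.norm.sub hi)).1 h.symm
    filter_upwards [this] with ω hω
    have h2 : ‖v ω‖ - v ω = 0 := hω
    have : v ω = |v ω| := by rw [← Real.norm_eq_abs]; linarith
    rw [this]; exact abs_nonneg _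
  have abs_lt : ∀ v ∈ L, v ≠ 0 → |∫ ω, v ω ∂μ| < ‖v‖ := by
    intro v hv hv0
    have h1 := norm_sub_integral_pos v hv hv0
    have h2 := norm_sub_integral_pos (-v) (L.neg_mem hv) (neg_ne_zero.2 hv0)
    rw [norm_neg, integral_congr_ae (Lp.coeFn_neg v)] at h2
    simp only [Pi.neg_apply, integral_neg] at h2
    exact abs_lt.2 ⟨by linarith, by linarith⟩
  have : ProperSpace L := FiniteDimensional.proper ℝ L
  have hcont : Continuous fun v : L => |∫ ω, (v : Lp ℝ 1 μ) ω ∂μ| :=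
    (continuous_integral.comp continuous_subtype_val).abs
  rcases subsingleton_or_nontrivial L with hs | hs
  · refine ⟨0, le_rfl, one_pos, fun v hv => ?_⟩
    have : v = 0 := congrArg Subtype.val (Subsingleton.elim (⟨v, hv⟩ : L) 0)
    subst this
    rw [integral_congr_ae (Lp.coeFn_zero ℝ 1 μ)]
    simp
  · obtain ⟨u, hu, hmax⟩ := (isCompact_sphere (0 : L) 1).exists_isMaxOn
      (NormedSpace.sphere_nonempty.2 zero_le_one) hcont.continuousOn
    have hu1 : ‖u‖ = 1 := by simpa using hu
    have hu0 : (u : Lp ℝ 1 μ) ≠ 0 := fun h => by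
      rw [Submodule.coe_norm, h, norm_zero] at hu1; exact zero_ne_one hu1
    refine ⟨_, abs_nonneg (∫ ω, (u : Lp ℝ 1 μ) ω ∂μ), ?_, fun v hv => ?_⟩
    · have := abs_lt u u.2 hu0
      rwa [← Submodule.coe_norm, hu1] at this
    by_cases hv0 : v = 0
    · subst hv0
      rw [integral_congr_ae (Lp.coeFn_zero ℝ 1 μ)]
      simp
    have hn : 0 < ‖v‖ := norm_pos_iff.2 hv0
    have hmem : (⟨‖v‖⁻¹ • v, L.smul_mem _ hv⟩ : L) ∈ Metric.sphere (0 : L) 1 := by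
      simp [norm_smul, hn.ne']
    have h : |∫ ω, (‖v‖⁻¹ • v : Lp ℝ 1 μ) ω ∂μ| ≤ |∫ ω, (u : Lp ℝ 1 μ) ω ∂μ| := hmax hmem
    rw [integral_congr_ae (Lp.coeFn_smul ‖v‖⁻¹ v)] at h
    simp only [Pi.smul_apply, smul_eq_mul, integral_const_mul, abs_mul, abs_inv, abs_norm] at h
    rwa [inv_mul_le_iff₀ hn, mul_comm] at h

/-- Differentiation of `∫ h (v + s w)` at `s = 0` when `h` has a bounded derivative. -/
theorem hasDerivAt_integral_comp_add_mul {Ω : Type*} [MeasurableSpace Ω] {μ : Measure Ω}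
    {h h' : ℝ → ℝ} {C : ℝ} (hd : ∀ y, HasDerivAt h (h' y) y) (hc : Continuous h')
    (hC : ∀ y, |h' y| ≤ C) {v w : Ω → ℝ} (hv : Integrable v μ) (hw : Integrable w μ)
    (hhv : Integrable (fun ω => h (v ω)) μ) :
    HasDerivAt (fun s : ℝ => ∫ ω, h (v ω + s * w ω) ∂μ) (∫ ω, h' (v ω) * w ω ∂μ) 0 := by
  have hcont : Continuous h := continuous_iff_continuousAt.2 fun y => (hd y).continuousAt
  have key := hasDerivAt_integral_of_dominated_loc_of_deriv_le (μ := μ) (𝕜 := ℝ) (x₀ := 0)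
    (s := Set.univ) (F := fun s ω => h (v ω + s * w ω))
    (F' := fun s ω => h' (v ω + s * w ω) * w ω) (bound := fun ω => C * |w ω|) univ_mem
    (Eventually.of_forall fun s =>
      hcont.comp_aestronglyMeasurable (hv.1.add (hw.1.const_mul s)))
    (by simpa using hhv)
    ((hc.comp_aestronglyMeasurable (hv.1.add (hw.1.const_mul 0))).mul hw.1)
    (Eventually.of_forall fun ω s _ => by
      rw [Real.norm_eq_abs, abs_mul]
      exact mul_le_mul_of_nonneg_right (hC _) (abs_nonneg _))
    (hw.abs.const_mul C)
    (Eventually.of_forall fun ω s _ => by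
      have h1 : HasDerivAt (fun s : ℝ => v ω + s * w ω) (w ω) s := by
        simpa using ((hasDerivAt_id s).mul_const (w ω)).const_add (v ω)
      exact (hd _).comp s h1)
  simpa using key.2

theorem hasDerivAt_sqrt_one_add_sq (y : ℝ) :
    HasDerivAt (fun y : ℝ => √(1 + y ^ 2)) (y / √(1 + y ^ 2)) y := by
  have h1 : HasDerivAt (fun y : ℝ => 1 + y ^ 2) (2 * y) y := by
    simpa using (hasDerivAt_pow 2 y).const_add 1
  convert h1.sqrt (by positivity) using 1
  field_simp

theorem abs_le_sqrt_one_add_sq (y : ℝ) : |y| ≤ √(1 + y ^ 2) :=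
  Real.abs_le_sqrt (by linarith)

theorem abs_div_sqrt_one_add_sq_le_one (y : ℝ) : |y / √(1 + y ^ 2)| ≤ 1 := by
  rw [abs_div, abs_of_nonneg (Real.sqrt_nonneg (1 + y ^ 2))]
  exact div_le_one_of_le₀ (abs_le_sqrt_one_add_sq y) (Real.sqrt_nonneg _)

/-- A finite dimensional subspace of `L¹` on which `|∫ v| ≤ c ‖v‖` with `c < 1` is annihilated by
a density bounded above and away from `0`; it is the derivative of a convex utility at its
minimizer. -/
theorem exists_bounded_density_integral_mul_eq_zero {Ω : Type*} [MeasurableSpace Ω]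
    {μ : Measure Ω} [IsProbabilityMeasure μ] (L : Submodule ℝ (Lp ℝ 1 μ))
    [FiniteDimensional ℝ L] {c : ℝ} (hc0 : 0 ≤ c) (hc1 : c < 1)
    (hc : ∀ v ∈ L, |∫ ω, v ω ∂μ| ≤ c * ‖v‖) :
    ∃ (ρ : Ω → ℝ) (r s : ℝ), Measurable ρ ∧ 0 < r ∧ (∀ ω, r ≤ ρ ω ∧ ρ ω ≤ s) ∧
      ∀ v ∈ L, ∫ ω, ρ ω * v ω ∂μ = 0 := by
  obtain ⟨t, ht1, htc⟩ : ∃ t : ℝ, 1 < t ∧ t * c < 1 := by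
    refine ⟨2 / (1 + c), (one_lt_div (by linarith)).2 (by linarith), ?_⟩
    rw [div_mul_eq_mul_div, div_lt_one (by linarith)]
    linarith
  set h : ℝ → ℝ := fun y => √(1 + y ^ 2) - 1 + t * y with hh
  set h' : ℝ → ℝ := fun y => y / √(1 + y ^ 2) + t with hh'
  have hd : ∀ y, HasDerivAt h (h' y) y := fun y =>
    ((hasDerivAt_sqrt_one_add_sq y).sub_const 1).add (hasDerivAt_const_mul t)
  have hcont' : Continuous h' :=
    (continuous_id.div (by fun_prop) fun y => by positivity).add continuous_const
  have hbd : ∀ y, t - 1 ≤ h' y ∧ h' y ≤ t + 1 := fun y => by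
    have := abs_le.1 (abs_div_sqrt_one_add_sq_le_one y)
    exact ⟨by simp only [hh']; linarith, by simp only [hh']; linarith⟩
  have habs : ∀ y, |h' y| ≤ t + 1 := fun y =>
    abs_le.2 ⟨by linarith [(hbd y).1], (hbd y).2⟩
  have hlip : LipschitzWith (t + 1).toNNReal h := by
    refine lipschitzWith_of_nnnorm_deriv_le (fun y => (hd y).differentiableAt) fun y => ?_
    rw [(hd y).deriv, ← NNReal.coe_le_coe, Real.coe_toNNReal _ (by linarith), coe_nnnorm]
    exact habs y
  have h0 : h 0 = 0 := by simp [hh]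
  have hint : ∀ v : Lp ℝ 1 μ, Integrable (fun ω => h (v ω)) μ := fun v =>
    (L1.integrable_coeFn (hlip.compLp h0 v)).congr (hlip.coeFn_compLp h0 v)
  set φ : L → ℝ := fun v => ∫ ω, h ((v : Lp ℝ 1 μ) ω) ∂μ
  have hφc : Continuous φ := by
    have := (continuous_integral (G := ℝ) (μ := μ)).comp
      ((hlip.continuous_compLp (μ := μ) (p := 1) h0).comp (continuous_subtype_val (p := (· ∈ L))))
    refine this.congr fun v => ?_
    exact integral_congr_ae (hlip.coeFn_compLp h0 _)
  have hlow : ∀ v : L, (1 - t * c) * ‖v‖ - 1 ≤ φ v := fun v => by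
    have hi := L1.integrable_coeFn (v : Lp ℝ 1 μ)
    have h1 : ∫ ω, (‖(v : Lp ℝ 1 μ) ω‖ - 1 + t * (v : Lp ℝ 1 μ) ω) ∂μ ≤ φ v := by
      refine integral_mono ((hi.norm.sub (integrable_const 1)).add (hi.const_mul t)) (hint v) ?_
      intro ω
      have := abs_le_sqrt_one_add_sq ((v : Lp ℝ 1 μ) ω)
      simp only [hh, Real.norm_eq_abs]
      linarith
    rw [integral_add (f := fun ω => ‖(v : Lp ℝ 1 μ) ω‖ - 1)
        (hi.norm.sub (integrable_const 1)) (hi.const_mul t),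
      integral_sub hi.norm (integrable_const 1), integral_const_mul,
      ← L1.norm_eq_integral_norm] at h1
    have h2 := (abs_le.1 (hc v v.2)).1
    rw [Submodule.coe_norm]
    simp only [integral_const, probReal_univ, smul_eq_mul, one_mul] at h1
    nlinarith
  have : ProperSpace L := FiniteDimensional.proper ℝ L
  have hlim : Tendsto φ (cocompact L) atTop := by
    refine tendsto_atTop_mono hlow ?_
    exact tendsto_atTop_add_const_right _ (-1)
      ((tendsto_norm_cocompact_atTop (E := L)).const_mul_atTop (sub_pos.2 htc))
  obtain ⟨v, hv⟩ := hφc.exists_forall_le hlim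
  have hm : Measurable fun ω => h' ((v : Lp ℝ 1 μ) ω) :=
    hcont'.measurable.comp (Lp.stronglyMeasurable _).measurable
  refine ⟨fun ω => h' ((v : Lp ℝ 1 μ) ω), t - 1, t + 1, hm, by linarith, fun ω => hbd _,
    fun w hw => ?_⟩
  have hder := hasDerivAt_integral_comp_add_mul hd hcont' habs
    (L1.integrable_coeFn (v : Lp ℝ 1 μ)) (L1.integrable_coeFn w) (hint v)
  refine IsLocalMin.hasDerivAt_eq_zero (Eventually.of_forall fun s => ?_) hder
  have hs : φ (v + s • ⟨w, hw⟩) = ∫ ω, h ((v : Lp ℝ 1 μ) ω + s * w ω) ∂μ := by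
    refine integral_congr_ae ?_
    filter_upwards [Lp.coeFn_add (v : Lp ℝ 1 μ) (s • w), Lp.coeFn_smul s w] with ω h1 h2
    simp only [Pi.add_apply, Pi.smul_apply, smul_eq_mul] at h1 h2
    rw [← h2, ← h1]
    rfl
  simp only [zero_mul, add_zero]
  rw [← hs]
  exact hv _

/-- Normalizing a bounded density `ρ` gives an equivalent probability measure. -/
theorem exists_isProbabilityMeasure_of_bounded_density {Ω : Type*} [MeasurableSpace Ω]
    {μ : Measure Ω} [IsProbabilityMeasure μ] {ρ : Ω → ℝ} {r s : ℝ} (hρ : Measurable ρ)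
    (hr : 0 < r) (hb : ∀ ω, r ≤ ρ ω ∧ ρ ω ≤ s) :
    ∃ (P : Measure Ω) (a b : ℝ), IsProbabilityMeasure P ∧ 0 < a ∧ a ≤ b ∧
      (∀ A : Set Ω, MeasurableSet A →
        ENNReal.ofReal a * μ A ≤ P A ∧ P A ≤ ENNReal.ofReal b * μ A) ∧
      ∀ Y : Ω → ℝ, Integrable Y μ → ∫ ω, ρ ω * Y ω ∂μ = 0 →
        Integrable Y P ∧ ∫ ω, Y ω ∂P = 0 := by
  have hρi : Integrable ρ μ := by
    refine Integrable.of_bound hρ.aestronglyMeasurable s (Eventually.of_forall fun ω => ?_)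
    rw [Real.norm_eq_abs, abs_of_nonneg (hr.le.trans (hb ω).1)]
    exact (hb ω).2
  set m : ℝ := ∫ ω, ρ ω ∂μ
  have hm : 0 < m := by
    refine hr.trans_le ?_
    simpa using integral_mono (integrable_const r) hρi fun ω => (hb ω).1
  have hrs : r ≤ s := by
    obtain ⟨ω⟩ := nonempty_of_isProbabilityMeasure μ
    exact (hb ω).1.trans (hb ω).2
  have hpos : ∀ ω, 0 ≤ ρ ω / m := fun ω => div_nonneg (hr.le.trans (hb ω).1) hm.le
  have hfm : Measurable fun ω => ENNReal.ofReal (ρ ω / m) := (hρ.div_const m).ennreal_ofReal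
  have htop : ∀ᵐ ω ∂μ, ENNReal.ofReal (ρ ω / m) < ⊤ :=
    Eventually.of_forall fun _ => ENNReal.ofReal_lt_top
  refine ⟨μ.withDensity fun ω => ENNReal.ofReal (ρ ω / m), r / m, s / m, ⟨?_⟩, div_pos hr hm,
    by gcongr, fun A hA => ?_, fun Y hY hY0 => ?_⟩
  · rw [withDensity_apply _ MeasurableSet.univ, Measure.restrict_univ,
      ← ofReal_integral_eq_lintegral_ofReal (hρi.div_const m) (Eventually.of_forall hpos),
      integral_div, div_self hm.ne', ENNReal.ofReal_one]
  · rw [withDensity_apply _ hA, ← setLIntegral_const, ← setLIntegral_const]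
    refine ⟨lintegral_mono fun ω => ?_, lintegral_mono fun ω => ?_⟩
    · have := (hb ω).1
      gcongr
    · have := (hb ω).2
      gcongr
  · have hr' : ∀ ω, (ENNReal.ofReal (ρ ω / m)).toReal = ρ ω / m := fun ω =>
      ENNReal.toReal_ofReal (hpos ω)
    rw [integrable_withDensity_iff_integrable_smul' hfm htop,
      integral_withDensity_eq_integral_toReal_smul hfm htop]
    simp only [hr', smul_eq_mul, div_mul_eq_mul_div]
    refine ⟨(hY.bdd_mul (c := s) hρ.aestronglyMeasurable
      (Eventually.of_forall fun ω => ?_)).div_const m, ?_⟩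
    · rw [Real.norm_eq_abs, abs_of_nonneg (hr.le.trans (hb ω).1)]
      exact (hb ω).2
    · rw [integral_div, hY0, zero_div]

/-- **Finite dimensional FTAP, integrable case.**
Let `X₁, …, X_d` be `P₀`-integrable random variables satisfying the no-arbitrage
condition on the linear space `L` they generate. Then:
(i) there is `c ∈ [0, 1)` with `|E_{P₀}(X)| ≤ c·E_{P₀}(|X|)` for every `X ∈ L`, and
(ii) there are a σ-additive probability `P` and constants `0 < r ≤ s` with
`r·P₀ ≤ P ≤ s·P₀` and `E_P(X) = 0` for every `X ∈ L`. -/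
theorem stmt_15 {Ω : Type*} [MeasurableSpace Ω] (P₀ : Measure Ω) [IsProbabilityMeasure P₀]
    (d : ℕ) (X : Fin d → Ω → ℝ) (hXmeas : ∀ j, Measurable (X j))
    (hXint : ∀ j, Integrable (X j) P₀)
    (hNA : ∀ b : Fin d → ℝ,
      (∀ᵐ ω ∂P₀, 0 ≤ ∑ j, b j * X j ω) → (∀ᵐ ω ∂P₀, ∑ j, b j * X j ω = 0)) :
    (∃ c : ℝ, 0 ≤ c ∧ c < 1 ∧ ∀ b : Fin d → ℝ,
      |∫ ω, (∑ j, b j * X j ω) ∂P₀| ≤ c * ∫ ω, |∑ j, b j * X j ω| ∂P₀) ∧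
    (∃ (P : Measure Ω) (r s : ℝ), IsProbabilityMeasure P ∧ 0 < r ∧ r ≤ s ∧
      (∀ A : Set Ω, MeasurableSet A →
        ENNReal.ofReal r * P₀ A ≤ P A ∧ P A ≤ ENNReal.ofReal s * P₀ A) ∧
      ∀ b : Fin d → ℝ, Integrable (fun ω => ∑ j, b j * X j ω) P ∧
        ∫ ω, (∑ j, b j * X j ω) ∂P = 0) := by
  set L : Submodule ℝ (Lp ℝ 1 P₀) :=
    Submodule.span ℝ (Set.range fun j => (hXint j).toL1 (X j))
  have hcoe : ∀ b : Fin d → ℝ, (∑ j, b j • (hXint j).toL1 (X j) : Lp ℝ 1 P₀) =ᵐ[P₀]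
      fun ω => ∑ j, b j * X j ω := fun b => by
    filter_upwards [Lp.coeFn_finsetSum Finset.univ fun j => b j • (hXint j).toL1 (X j),
      ae_all_iff.2 fun j => Lp.coeFn_smul (b j) ((hXint j).toL1 (X j)),
      ae_all_iff.2 fun j => (hXint j).coeFn_toL1] with ω h1 h2 h3
    simp only [h1, Finset.sum_apply, h2, Pi.smul_apply, h3, smul_eq_mul]
  have hmem : ∀ b : Fin d → ℝ, ∑ j, b j • (hXint j).toL1 (X j) ∈ L := fun b =>
    (Submodule.mem_span_range_iff_exists_fun ℝ).2 ⟨b, rfl⟩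
  have hfin : FiniteDimensional ℝ L := FiniteDimensional.span_of_finite ℝ (Set.finite_range _)
  have hL : ∀ v ∈ L, 0 ≤ᵐ[P₀] v → v = 0 := by
    intro v hv hv0
    obtain ⟨b, rfl⟩ := (Submodule.mem_span_range_iff_exists_fun ℝ).1 hv
    rw [Lp.eq_zero_iff_ae_eq_zero]
    exact (hcoe b).trans (hNA b (hv0.trans_eq (hcoe b)))
  obtain ⟨c, hc0, hc1, hc⟩ := exists_abs_integral_le_mul_norm L hL
  refine ⟨⟨c, hc0, hc1, fun b => ?_⟩, ?_⟩
  · have h := hc _ (hmem b)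
    have hnorm := integral_congr_ae ((hcoe b).fun_comp norm)
    simp only [Function.comp_apply] at hnorm
    rwa [L1.norm_eq_integral_norm, integral_congr_ae (hcoe b), hnorm] at h
  · obtain ⟨ρ, r, s, hρ, hr, hb, hρ0⟩ :=
      exists_bounded_density_integral_mul_eq_zero L hc0 hc1 hc
    obtain ⟨P, p, q, hP, hp, hpq, hA, hY⟩ :=
      exists_isProbabilityMeasure_of_bounded_density (μ := P₀) hρ hr hb
    refine ⟨P, p, q, hP, hp, hpq, hA, fun b => hY _ ?_ ?_⟩
    · exact integrable_finsetSum _ fun j _ => (hXint j).const_mul (b j)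
    · rw [← hρ0 _ (hmem b)]
      refine integral_congr_ae ?_
      filter_upwards [hcoe b] with ω hω
      rw [hω]
end

section
/- Let X₁, …, X_d be bounded real random variables on (Ω, 𝒜, P₀) with E_{P₀}(X_j) = 0 for each j, and let f : Ω → (0, ∞) be a measurable function with E_{P₀}(f) = 1. Then there exists a measurable function g : Ω → [0, ∞) such that g ≥ f P₀-a.s., E_{P₀}(g) < ∞, and E_{P₀}(g·X_j) = 0 for every j = 1, …, d (equivalently, E_{P₀}(g·X) = 0 for every X in the linear span of X₁, …, X_d). -/
open MeasureTheory Filter Topology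

/-- In finite dimension, a convex cone on which every nonnegative linear functional vanishes
is closed under negation. -/
theorem PointedCone.neg_mem_of_forall_functional_eq_zero {E : Type*} [NormedAddCommGroup E]
    [NormedSpace ℝ E] [FiniteDimensional ℝ E] (C : PointedCone ℝ E)
    (hC : ∀ φ : E →ₗ[ℝ] ℝ, (∀ x ∈ C, 0 ≤ φ x) → ∀ x ∈ C, φ x = 0) {c : E} (hc : c ∈ C) :
    -c ∈ C := by
  by_contra hneg
  let V : Submodule ℝ E := Submodule.span ℝ (C : Set E)
  have hCV : ∀ x ∈ C, x ∈ V := fun x hx => Submodule.subset_span hx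
  let S : Set V := ((↑) : V → E) ⁻¹' (C : Set E)
  have hSconv : Convex ℝ S :=
    (PointedCone.convex C).linear_preimage V.subtype
  have hSspan : Submodule.span ℝ S = ⊤ := Submodule.span_span_coe_preimage
  have hSint : (interior S).Nonempty := by
    rw [hSconv.interior_nonempty_iff_affineSpan_eq_top]
    have h0 : (0 : V) ∈ S := C.zero_mem
    have hle : Submodule.span ℝ S ≤ (affineSpan ℝ S).direction := by
      rw [Submodule.span_le]
      intro x hx
      simpa using AffineSubspace.vsub_mem_direction (subset_affineSpan ℝ S hx)
        (subset_affineSpan ℝ S h0)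
    rw [hSspan, top_le_iff] at hle
    exact (AffineSubspace.direction_eq_top_iff_of_nonempty
      ⟨0, subset_affineSpan ℝ S h0⟩).1 hle
  let c' : V := ⟨c, hCV c hc⟩
  have hc' : -c' ∉ interior S := fun h =>
    hneg (interior_subset h : -c' ∈ S)
  obtain ⟨φ, hφ⟩ := geometric_hahn_banach_open_point hSconv.interior isOpen_interior hc'
  have hφle : ∀ x ∈ S, φ x ≤ φ (-c') := by
    intro x hx
    have hx' : x ∈ closure (interior S) := by
      rw [hSconv.closure_interior_eq_closure_of_nonempty_interior hSint]
      exact subset_closure hx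
    exact closure_minimal (fun y hy => (hφ y hy).le)
      (isClosed_le φ.continuous continuous_const) hx'
  have hφnonpos : ∀ x ∈ S, φ x ≤ 0 := by
    intro x hx
    by_contra! hpos
    obtain ⟨n, hn⟩ := exists_nat_gt (φ (-c') / φ x)
    rw [div_lt_iff₀ hpos] at hn
    have hnx : n • x ∈ S := by
      change ((n • x : V) : E) ∈ C
      simpa using C.nsmul_mem hx n
    have := hφle _ hnx
    rw [map_nsmul, nsmul_eq_mul] at this
    linarith
  obtain ⟨ψ, hψ⟩ := LinearMap.exists_extend (-φ : V →L[ℝ] ℝ).toLinearMap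
  have hψV : ∀ x : V, ψ x = -φ x := fun x => LinearMap.congr_fun hψ x
  have hzero : ∀ x ∈ S, φ x = 0 := by
    intro x hx
    have := hC ψ (fun y hy => by
      have h1 := hψV ⟨y, hCV y hy⟩
      have h2 := hφnonpos ⟨y, hCV y hy⟩ hy
      simp only at h1
      linarith) x hx
    rw [hψV] at this
    linarith
  obtain ⟨x, hx⟩ := hSint
  have h1 := hφ x hx
  rw [hzero x (interior_subset hx), map_neg, hzero c' hc] at h1
  simp at h1

/-- A bounded random variable with zero mean whose integral against every integrable nonnegative
density is nonnegative vanishes almost surely. -/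
theorem ae_eq_zero_of_forall_integral_mul_nonneg {Ω : Type*} [MeasurableSpace Ω]
    {P : Measure Ω} [IsFiniteMeasure P] {Z : Ω → ℝ} (hZ : Measurable Z) {M : ℝ}
    (hM : ∀ ω, |Z ω| ≤ M) (hmean : ∫ ω, Z ω ∂P = 0)
    (h : ∀ k : Ω → ℝ, Measurable k → (∀ ω, 0 ≤ k ω) → Integrable k P →
      0 ≤ ∫ ω, k ω * Z ω ∂P) : Z =ᵐ[P] 0 := by
  have hZint : Integrable Z P :=
    Integrable.of_bound hZ.aestronglyMeasurable M (ae_of_all _ hM)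
  have hkint : Integrable (fun ω => max (-Z ω) 0) P := hZint.neg.pos_part
  have hkk : Integrable (fun ω => max (-Z ω) 0 * Z ω) P :=
    hkint.mul_bdd (c := M) hZ.aestronglyMeasurable (ae_of_all _ hM)
  have hle : 0 ≤ fun ω => -(max (-Z ω) 0 * Z ω) := by
    intro ω
    rcases le_total (-Z ω) 0 with h0 | h0
    · simp [max_eq_right h0]
    · simp only [Pi.zero_apply, max_eq_left h0]
      nlinarith
  have h1 : 0 ≤ ∫ ω, max (-Z ω) 0 * Z ω ∂P :=
    h _ (hZ.neg.max measurable_const) (fun ω => le_max_right _ _) hkint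
  have h2 : ∫ ω, -(max (-Z ω) 0 * Z ω) ∂P = 0 := by
    have := integral_nonneg (μ := P) hle
    rw [integral_neg] at this ⊢
    linarith
  rw [integral_eq_zero_iff_of_nonneg hle hkk.neg] at h2
  have hnonneg : 0 ≤ᵐ[P] Z := by
    filter_upwards [h2] with ω hω
    by_contra! hneg
    simp only [Pi.zero_apply] at hω hneg
    rw [max_eq_left (by linarith)] at hω
    nlinarith
  exact (integral_eq_zero_iff_of_nonneg_ae hnonneg hZint).1 hmean

/-- The cone of vectors `(∫ k X₁, …, ∫ k X_d)` for `k` ranging over the nonnegative integrable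
densities. -/
def densityMomentCone {Ω : Type*} [MeasurableSpace Ω] (P : Measure Ω) {d : ℕ}
    (X : Fin d → Ω → ℝ) (hX : ∀ k : Ω → ℝ, Integrable k P →
      ∀ j, Integrable (fun ω => k ω * X j ω) P) : PointedCone ℝ (Fin d → ℝ) where
  carrier := {y | ∃ k : Ω → ℝ, Measurable k ∧ (∀ ω, 0 ≤ k ω) ∧ Integrable k P ∧
    ∀ j, y j = ∫ ω, k ω * X j ω ∂P}
  add_mem' := by
    rintro y z ⟨k, hk, hk0, hki, hky⟩ ⟨l, hl, hl0, hli, hlz⟩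
    refine ⟨fun ω => k ω + l ω, hk.add hl, fun ω => add_nonneg (hk0 ω) (hl0 ω), hki.add hli,
      fun j => ?_⟩
    simp only [add_mul, Pi.add_apply]
    rw [integral_add (hX k hki j) (hX l hli j), hky, hlz]
  zero_mem' := ⟨fun _ => 0, measurable_const, fun _ => le_rfl, integrable_zero _ _ _,
    fun j => by simp⟩
  smul_mem' := by
    rintro ⟨a, ha⟩ y ⟨k, hk, hk0, hki, hky⟩
    refine ⟨fun ω => a * k ω, hk.const_mul a, fun ω => mul_nonneg ha (hk0 ω), hki.const_mul a,
      fun j => ?_⟩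
    simp only [mul_assoc]
    rw [integral_const_mul, ← hky]
    rfl

/-- **Answer to a question of Rokhlin and Schachermayer (finite dimensional case).**
Let `X₁, …, X_d` be bounded random variables with `E_{P₀}(X_j) = 0`, and `f > 0` with
`E_{P₀}(f) = 1`. Then there is a measurable `g ≥ 0` with `g ≥ f` a.s.,
`E_{P₀}(g) < ∞` and `E_{P₀}(g·X_j) = 0` for all `j`. -/
theorem stmt_16 {Ω : Type*} [MeasurableSpace Ω] (P₀ : Measure Ω) [IsProbabilityMeasure P₀]
    (d : ℕ) (X : Fin d → Ω → ℝ) (hXmeas : ∀ j, Measurable (X j))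
    (hXbdd : ∀ j, ∃ M : ℝ, ∀ ω, |X j ω| ≤ M)
    (hXmean : ∀ j, ∫ ω, X j ω ∂P₀ = 0)
    (f : Ω → ℝ) (hfmeas : Measurable f) (hfpos : ∀ ω, 0 < f ω)
    (hfint : Integrable f P₀) (hf1 : ∫ ω, f ω ∂P₀ = 1) :
    ∃ g : Ω → ℝ, Measurable g ∧ (∀ ω, 0 ≤ g ω) ∧ (∀ᵐ ω ∂P₀, f ω ≤ g ω) ∧
      Integrable g P₀ ∧
      ∀ j, Integrable (fun ω => g ω * X j ω) P₀ ∧ ∫ ω, g ω * X j ω ∂P₀ = 0 := by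
  choose M hM using hXbdd
  have hX : ∀ k : Ω → ℝ, Integrable k P₀ → ∀ j, Integrable (fun ω => k ω * X j ω) P₀ :=
    fun k hk j => hk.mul_bdd (c := M j) (hXmeas j).aestronglyMeasurable (ae_of_all _ (hM j))
  have hXint : ∀ j, Integrable (X j) P₀ := fun j =>
    Integrable.of_bound (hXmeas j).aestronglyMeasurable (M j) (ae_of_all _ (hM j))
  have hneg := (densityMomentCone P₀ X hX).neg_mem_of_forall_functional_eq_zero
    (c := fun j => ∫ ω, f ω * X j ω ∂P₀) ?_
    ⟨f, hfmeas, fun ω => (hfpos ω).le, hfint, fun j => rfl⟩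
  · obtain ⟨k, hk, hk0, hki, hkX⟩ := hneg
    refine ⟨fun ω => f ω + k ω, hfmeas.add hk, fun ω => add_nonneg (hfpos ω).le (hk0 ω),
      ae_of_all _ fun ω => le_add_of_nonneg_right (hk0 ω), hfint.add hki,
      fun j => ⟨hX _ (hfint.add hki) j, ?_⟩⟩
    simp only [add_mul]
    rw [integral_add (hX f hfint j) (hX k hki j), ← hkX j]
    simp
  · intro φ hφ
    let a : Fin d → ℝ := fun j => φ (Pi.single j 1)
    let Z : Ω → ℝ := fun ω => ∑ j, a j * X j ω
    have hφZ : ∀ (k : Ω → ℝ), Integrable k P₀ → ∀ y : Fin d → ℝ,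
        (∀ j, y j = ∫ ω, k ω * X j ω ∂P₀) → φ y = ∫ ω, k ω * Z ω ∂P₀ := by
      intro k hki y hy
      have h1 : ∀ ω, k ω * Z ω = ∑ j, a j * (k ω * X j ω) := fun ω => by
        simp only [Z, Finset.mul_sum]
        exact Finset.sum_congr rfl fun j _ => by ring
      simp only [h1]
      rw [integral_finsetSum _ fun j _ => (hX k hki j).const_mul (a j),
        LinearMap.pi_apply_eq_sum_univ φ y]
      refine Finset.sum_congr rfl fun j _ => ?_
      rw [integral_const_mul, ← hy j, smul_eq_mul, mul_comm]
      congr 2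
      ext i
      simp [Pi.single_apply, eq_comm]
    have hZ0 : Z =ᵐ[P₀] 0 := by
      refine ae_eq_zero_of_forall_integral_mul_nonneg (M := ∑ j, |a j| * M j)
        (Finset.measurable_fun_sum _ fun j _ => (hXmeas j).const_mul (a j)) (fun ω => ?_) ?_ ?_
      · refine (Finset.abs_sum_le_sum_abs _ _).trans (Finset.sum_le_sum fun j _ => ?_)
        rw [abs_mul]
        exact mul_le_mul_of_nonneg_left (hM j ω) (abs_nonneg _)
      · rw [integral_finsetSum _ fun j _ => (hXint j).const_mul (a j)]
        simp [integral_const_mul, hXmean]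
      · intro k hk hk0 hki
        rw [← hφZ k hki _ fun j => rfl]
        exact hφ _ ⟨k, hk, hk0, hki, fun j => rfl⟩
    rintro y ⟨k, hk, hk0, hki, hky⟩
    rw [hφZ k hki y hky]
    refine integral_eq_zero_of_ae ?_
    filter_upwards [hZ0] with ω hω
    simp [hω]
end

section
/- Let X₁, X₂, … be random variables on (Ω, 𝒜, P₀) with values in {−1, 1} such that ∑_{n=1}^∞ P₀(Xₙ = −1) < ∞. Then for every σ-additive probability measure Q on 𝒜 with Q ~ P₀ one has E_Q(Xₙ) → 1 as n → ∞; in particular, there is no σ-additive probability measure Q with Q ~ P₀ satisfying E_Q(Xₙ) ≤ 0 for all n (so the linear space generated by (Xₙ) admits no equivalent super-martingale measure). -/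
open MeasureTheory Filter Topology

/-- `±1`-valued variables whose failure probabilities are summable under `P` have expectations
tending to `1` under every probability measure absolutely continuous with respect to `P`. -/
theorem tendsto_integral_one_of_summable_measure_eq_neg_one {Ω : Type*} [MeasurableSpace Ω]
    {P Q : Measure Ω} [IsFiniteMeasure P] [IsProbabilityMeasure Q] (hQP : Q ≪ P)
    {X : ℕ → Ω → ℝ} (hXmeas : ∀ n, Measurable (X n))
    (hXval : ∀ n ω, X n ω = -1 ∨ X n ω = 1)
    (hsum : Summable fun n => (P {ω | X n ω = -1}).toReal) :
    Tendsto (fun n => ∫ ω, X n ω ∂Q) atTop (𝓝 1) := by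
  have hfin : ∑' n, P {ω | X n ω = -1} ≠ ⊤ := by
    simpa only [ENNReal.ofReal_toReal (measure_ne_top P _)] using hsum.tsum_ofReal_ne_top
  have hlim : ∀ᵐ ω ∂Q, Tendsto (fun n => X n ω) atTop (𝓝 1) := by
    filter_upwards [hQP.ae_le (ae_eventually_notMem hfin)] with ω hω
    exact tendsto_const_nhds.congr' (hω.mono fun n hn => ((hXval n ω).resolve_left hn).symm)
  have hbound : ∀ n, ∀ᵐ ω ∂Q, ‖X n ω‖ ≤ 1 := fun n => ae_of_all _ fun ω => by
    rcases hXval n ω with h | h <;> simp [h]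
  simpa using tendsto_integral_of_dominated_convergence (fun _ => (1 : ℝ))
    (fun n => (hXmeas n).aestronglyMeasurable) (integrable_const 1) hbound hlim

/-- **Example: no ESM for `±1`-valued variables with summable failure probabilities.**
If the `Xₙ` take values in `{−1, 1}` and `∑ₙ P₀(Xₙ = −1) < ∞`, then for every
σ-additive probability `Q ~ P₀` one has `E_Q(Xₙ) → 1`; in particular, no σ-additive
`Q ~ P₀` satisfies `E_Q(Xₙ) ≤ 0` for all `n`. -/
theorem stmt_17 {Ω : Type*} [MeasurableSpace Ω] (P₀ : Measure Ω) [IsProbabilityMeasure P₀]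
    (X : ℕ → Ω → ℝ) (hXmeas : ∀ n, Measurable (X n))
    (hXval : ∀ n ω, X n ω = -1 ∨ X n ω = 1)
    (hsum : Summable fun n => (P₀ {ω | X n ω = -1}).toReal) :
    (∀ Q : Measure Ω, IsProbabilityMeasure Q → Q ≪ P₀ → P₀ ≪ Q →
      Tendsto (fun n => ∫ ω, X n ω ∂Q) atTop (𝓝 1)) ∧
    ¬ ∃ Q : Measure Ω, IsProbabilityMeasure Q ∧ Q ≪ P₀ ∧ P₀ ≪ Q ∧
      ∀ n, ∫ ω, X n ω ∂Q ≤ 0 := by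
  refine ⟨fun Q _ hQP _ =>
    tendsto_integral_one_of_summable_measure_eq_neg_one hQP hXmeas hXval hsum, ?_⟩
  rintro ⟨Q, _, hQP, -, hle⟩
  exact absurd (le_of_tendsto'
    (tendsto_integral_one_of_summable_measure_eq_neg_one hQP hXmeas hXval hsum) hle)
    (by norm_num)
end

section
/- Let Y and Z be random variables on (Ω, 𝒜, P₀) with values in ℕ = {0, 1, 2, …} which, under P₀, are independent and each Poisson distributed with parameter 1 (so P₀(Y = j) = e^{−1}/j! for all j ∈ ℕ, and similarly for Z). Define X₀ = 1_{Y=0} − 1_{Z=0} and, for j ≥ 1, X_j = 1_{Y=j} − P₀(Y = j)·1_{Z>0}. Then there is no σ-additive probability measure P on 𝒜 with P ~ P₀ such that E_P(X_j) = 0 for all j ≥ 0; that is, the linear space generated by (X_j)_{j ≥ 0} admits no equivalent super-martingale measure. -/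
open MeasureTheory Filter Topology ProbabilityTheory

/-- The fibres of a measurable `ℕ`-valued map carry total mass one. -/
lemma hasSum_measureReal_fiber {Ω : Type*} [MeasurableSpace Ω] (P : Measure Ω)
    [IsProbabilityMeasure P] {Y : Ω → ℕ} (hY : Measurable Y) :
    HasSum (fun j => P.real {ω | Y ω = j}) 1 := by
  have h : ∑' j, P {ω | Y ω = j} = 1 := by
    rw [← measure_iUnion, ← measure_univ (μ := P)]
    · congr 1
      ext ω
      simp
    · intro i j hij
      exact Set.disjoint_left.2 fun ω hi hj => hij (hi.symm.trans hj)
    · exact fun j => hY (measurableSet_singleton j)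
  have h' := ENNReal.hasSum_toReal (f := fun j => P {ω | Y ω = j}) (by simp [h])
  rwa [← ENNReal.tsum_toReal_eq (fun j => measure_ne_top _ _), h, ENNReal.toReal_one] at h'

lemma integrable_ite_one {Ω : Type*} [MeasurableSpace Ω] (P : Measure Ω)
    [IsFiniteMeasure P] {p : Ω → Prop} [DecidablePred p] (hp : MeasurableSet {ω | p ω}) :
    Integrable (fun ω => if p ω then (1 : ℝ) else 0) P := by
  refine ((integrable_const (1 : ℝ)).indicator (μ := P) hp).congr (.of_forall fun ω => ?_)
  simp [Set.indicator_apply]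

lemma integral_ite_one {Ω : Type*} [MeasurableSpace Ω] (P : Measure Ω)
    {p : Ω → Prop} [DecidablePred p] (hp : MeasurableSet {ω | p ω}) :
    ∫ ω, (if p ω then (1 : ℝ) else 0) ∂P = P.real {ω | p ω} := by
  rw [← integral_indicator_one hp]
  congr 1 with ω
  simp [Set.indicator_apply]

/-- **Example: no ESM although ESFA's with small purely finitely additive part exist.**
Let `Y, Z` be independent Poisson(1) random variables under `P₀`, and define
`X₀ = 1_{Y=0} − 1_{Z=0}` and `X_j = 1_{Y=j} − P₀(Y=j)·1_{Z>0}` for `j ≥ 1`. Then no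
σ-additive probability `P ~ P₀` satisfies `E_P(X_j) = 0` for all `j ≥ 0`. -/
theorem stmt_18 {Ω : Type*} [MeasurableSpace Ω] (P₀ : Measure Ω) [IsProbabilityMeasure P₀]
    (Y Z : Ω → ℕ) (hYmeas : Measurable Y) (hZmeas : Measurable Z)
    (hindep : IndepFun Y Z P₀)
    (hYpois : ∀ j : ℕ, P₀ {ω | Y ω = j} = ENNReal.ofReal (Real.exp (-1) / j.factorial))
    (hZpois : ∀ j : ℕ, P₀ {ω | Z ω = j} = ENNReal.ofReal (Real.exp (-1) / j.factorial))
    (X : ℕ → Ω → ℝ)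
    (hX0 : X 0 = fun ω =>
      (if Y ω = 0 then (1 : ℝ) else 0) - (if Z ω = 0 then (1 : ℝ) else 0))
    (hXj : ∀ j : ℕ, 1 ≤ j → X j = fun ω =>
      (if Y ω = j then (1 : ℝ) else 0) -
        (P₀ {ω | Y ω = j}).toReal * (if 0 < Z ω then (1 : ℝ) else 0)) :
    ¬ ∃ P : Measure Ω, IsProbabilityMeasure P ∧ P ≪ P₀ ∧ P₀ ≪ P ∧
      ∀ j, ∫ ω, X j ω ∂P = 0 := by
  rintro ⟨P, _, -, hP₀P, hE⟩
  have hYm (j : ℕ) : MeasurableSet {ω | Y ω = j} := hYmeas (measurableSet_singleton j)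
  have hZm (j : ℕ) : MeasurableSet {ω | Z ω = j} := hZmeas (measurableSet_singleton j)
  have hZpos : MeasurableSet {ω | 0 < Z ω} := hZmeas measurableSet_Ioi
  have hmass (W : Ω → ℕ) (hW : ∀ j : ℕ, P₀ {ω | W ω = j} =
      ENNReal.ofReal (Real.exp (-1) / j.factorial)) (j : ℕ) : P₀ {ω | W ω = j} ≠ 0 := by
    rw [hW, ENNReal.ofReal_ne_zero_iff]
    positivity
  have hzero : P.real {ω | Y ω = 0} = 1 - P.real {ω | 0 < Z ω} := by
    have h := hE 0
    rw [hX0, integral_sub (integrable_ite_one P (hYm 0)) (integrable_ite_one P (hZm 0)),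
      integral_ite_one P (hYm 0), integral_ite_one P (hZm 0)] at h
    have hc := probReal_compl_eq_one_sub (μ := P) hZpos
    have hset : {ω | 0 < Z ω}ᶜ = {ω | Z ω = 0} := by
      ext ω
      simp
    rw [hset] at hc
    linarith
  have hpos (j : ℕ) (hj : 1 ≤ j) :
      P.real {ω | Y ω = j} = P₀.real {ω | Y ω = j} * P.real {ω | 0 < Z ω} := by
    have h := hE j
    rw [hXj j hj, integral_sub (integrable_ite_one P (hYm j))
      ((integrable_ite_one P hZpos).const_mul _), integral_const_mul,
      integral_ite_one P (hYm j), integral_ite_one P hZpos] at h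
    exact sub_eq_zero.1 h
  have hsum := (hasSum_nat_add_iff' 1).2 (hasSum_measureReal_fiber P hYmeas)
  have hsum₀ := ((hasSum_nat_add_iff' 1).2 (hasSum_measureReal_fiber P₀ hYmeas)).mul_right
    (P.real {ω | 0 < Z ω})
  simp only [fun j : ℕ => hpos (j + 1) (Nat.le_add_left 1 j)] at hsum
  have heq := hsum.unique hsum₀
  simp only [Finset.sum_range_one, hzero] at heq
  have hprod : P₀.real {ω | Y ω = 0} * P.real {ω | 0 < Z ω} = 0 := by linarith
  rcases mul_eq_zero.1 hprod with h | h
  · exact hmass Y hYpois 0 ((measureReal_eq_zero_iff).1 h)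
  · refine hmass Z hZpois 1 (measure_mono_null ?_ (hP₀P ((measureReal_eq_zero_iff).1 h)))
    intro ω (hω : Z ω = 1)
    simp [hω]
end
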